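/- Assume (1/N) log K(N) → 0 as N → ∞. Then for every β ≥ 0 and h ∈ ℝ the annealed free energy F^a(β,h) := lim_{N→∞} (1/N) log Z^a_N(β,h) exists, is nonnegative, and satisfies: F^a(β,h) > 0 if and only if h > −log λ(0,β,0). In particular the annealed critical curve is h_c^a(β) := sup{h : F^a(β,h) = 0} = −log λ(0,β,0). -/

import Mathlib

open Filter Topology Matrix

/-- Generic pinning sum: sum over the number of contacts `k`, the interarrival
times `s : Fin k → {0,…,N}` (all ≥ 1, summing to `N`) and the states
`x : Fin (k+1) → S`, of `μ0 (x 0)` times the product of the weights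
`W (tᵢ − tᵢ₋₁) (xᵢ₋₁) (xᵢ)`. -/
noncomputable def pinSum {S : Type*} [Fintype S] (μ0 : S → ℝ) (W : ℕ → S → S → ℝ)
    (N : ℕ) : ℝ :=
  ∑ k ∈ Finset.Icc 1 N, ∑ s : Fin k → Fin (N + 1),
    if (∀ i, 1 ≤ (s i : ℕ)) ∧ (∑ i, (s i : ℕ)) = N then
      ∑ x : Fin (k + 1) → S, μ0 (x 0) * ∏ i : Fin k, W (s i : ℕ) (x i.castSucc) (x i.succ)
    else 0

/-- The annealed partition function `Z^a_N(β,h)`. -/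
noncomputable def Za {S : Type*} [Fintype S] [DecidableEq S] (K : ℕ → ℝ) (Q : Matrix S S ℝ)
    (μ0 : S → ℝ) (f : S → ℝ) (β h : ℝ) (N : ℕ) : ℝ :=
  pinSum μ0 (fun t x y => K t * (Q ^ t) x y * Real.exp (β * f y + h)) N

/-- The matrix `A(b,β,h) = ∑_{t ≥ 1} M(t,β,h) e^{-bt}` where
`M(t,β,h)(x,y) = K(t) Q^t(x,y) e^{β f(y) + h}`. -/
noncomputable def Amat {S : Type*} [Fintype S] [DecidableEq S] (K : ℕ → ℝ) (Q : Matrix S S ℝ)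
    (f : S → ℝ) (b β h : ℝ) : Matrix S S ℝ :=
  Matrix.of fun x y => ∑' t : ℕ,
    K (t + 1) * (Q ^ (t + 1)) x y * Real.exp (β * f y + h) * Real.exp (-b * (t + 1))

/-- contribution of exactly `k` contacts, starting from `x`. -/
noncomputable def uK {S : Type*} [Fintype S] (W : ℕ → S → S → ℝ) : ℕ → ℕ → S → ℝ
  | 0, N, _ => if N = 0 then 1 else 0
  | k + 1, N, x => ∑ t ∈ Finset.Icc 1 N, ∑ y, W t x y * uK W k (N - t) y

/-- total weight starting from `x`. -/
noncomputable def vN {S : Type*} [Fintype S] (W : ℕ → S → S → ℝ) (N : ℕ) (x : S) : ℝ :=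
  ∑ k ∈ Finset.range (N + 1), uK W k N x

lemma uK_eq_zero {S : Type*} [Fintype S] (W : ℕ → S → S → ℝ) (k : ℕ) :
    ∀ N x, N < k → uK W k N x = 0 := by
  induction k with
  | zero => intro N x h; omega
  | succ k ih =>
    intro N x h
    simp only [uK]
    refine Finset.sum_eq_zero fun t ht => Finset.sum_eq_zero fun y _ => ?_
    rw [Finset.mem_Icc] at ht
    rw [ih _ _ (by omega), mul_zero]

lemma vN_eq {S : Type*} [Fintype S] (W : ℕ → S → S → ℝ) (N L : ℕ) (h : N < L) (x : S) :
    vN W N x = ∑ k ∈ Finset.range L, uK W k N x := by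
  unfold vN
  refine Finset.sum_subset (fun a ha => ?_) (fun k _ hk => uK_eq_zero W k N x ?_)
  · simp at ha ⊢; omega
  · simp at hk; omega

lemma vN_zero {S : Type*} [Fintype S] (W : ℕ → S → S → ℝ) (x : S) : vN W 0 x = 1 := by
  simp [vN, uK]

lemma vN_rec {S : Type*} [Fintype S] (W : ℕ → S → S → ℝ) (N : ℕ) (hN : 1 ≤ N) (x : S) :
    vN W N x = ∑ t ∈ Finset.Icc 1 N, ∑ y, W t x y * vN W (N - t) y := by
  have h1 : vN W N x = ∑ k ∈ Finset.range N, uK W (k + 1) N x := by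
    unfold vN
    rw [Finset.sum_range_succ']
    simp only [uK]
    rw [if_neg (by omega), add_zero]
  rw [h1]
  simp only [uK]
  rw [Finset.sum_comm]
  refine Finset.sum_congr rfl fun t ht => ?_
  rw [Finset.mem_Icc] at ht
  rw [Finset.sum_comm]
  refine Finset.sum_congr rfl fun y _ => ?_
  rw [vN_eq W (N - t) N (by omega), Finset.mul_sum]

/-- inner sum of the partition function -/
noncomputable def GG {S : Type*} [Fintype S] (W : ℕ → S → S → ℝ) (L k N : ℕ) (ν : S → ℝ) : ℝ :=
  ∑ s : Fin k → Fin (L + 1),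
    if (∀ i, 1 ≤ (s i : ℕ)) ∧ (∑ i, (s i : ℕ)) = N then
      ∑ x : Fin (k + 1) → S, ν (x 0) * ∏ i : Fin k, W (s i : ℕ) (x i.castSucc) (x i.succ)
    else 0

lemma sum_cons {n : ℕ} {A : Type*} [Fintype A] (g : (Fin (n + 1) → A) → ℝ) :
    ∑ x, g x = ∑ a : A, ∑ x : Fin n → A, g (Fin.cons a x) := by
  rw [← (Fin.consEquiv (fun _ : Fin (n + 1) => A)).sum_comp g, Fintype.sum_prod_type]
  rfl

lemma GG_succ {S : Type*} [Fintype S] (W : ℕ → S → S → ℝ) (L k N : ℕ) (hN : N ≤ L)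
    (ν : S → ℝ) :
    GG W L (k + 1) N ν =
      ∑ t ∈ Finset.Icc 1 N, GG W L k (N - t) (fun y => ∑ x, ν x * W t x y) := by
  have hinner : ∀ (t : Fin (L + 1)) (s : Fin k → Fin (L + 1)),
      (∑ x : Fin (k + 1 + 1) → S, ν (x 0) * ∏ i : Fin (k + 1),
        W ((Fin.cons t s : Fin (k + 1) → Fin (L + 1)) i : ℕ) (x i.castSucc) (x i.succ)) =
      ∑ x : Fin (k + 1) → S, (∑ z, ν z * W t z (x 0)) *
        ∏ i : Fin k, W (s i : ℕ) (x i.castSucc) (x i.succ) := by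
    intro t s
    rw [sum_cons, Finset.sum_comm]
    refine Finset.sum_congr rfl fun x _ => ?_
    rw [Finset.sum_mul]
    refine Finset.sum_congr rfl fun z _ => ?_
    rw [Fin.prod_univ_succ]
    simp only [Fin.cons_zero, Fin.cons_succ, Fin.castSucc_zero, ← Fin.succ_castSucc]
    rw [mul_assoc]
  have h1 : GG W L (k + 1) N ν = ∑ t : Fin (L + 1),
      if (t : ℕ) ∈ Finset.Icc 1 N then
        GG W L k (N - t) (fun y => ∑ x, ν x * W t x y) else 0 := by
    unfold GG
    rw [sum_cons]
    refine Finset.sum_congr rfl fun t _ => ?_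
    simp only [hinner]
    split_ifs with ht
    · refine Finset.sum_congr rfl fun s _ => ?_
      rw [Finset.mem_Icc] at ht
      congr 1
      rw [Fin.forall_fin_succ, Fin.sum_univ_succ]
      simp only [Fin.cons_zero, Fin.cons_succ, eq_iff_iff]
      constructor
      · rintro ⟨⟨_, h⟩, h'⟩
        exact ⟨h, by omega⟩
      · rintro ⟨h, h'⟩
        exact ⟨⟨ht.1, h⟩, by omega⟩
    · refine Finset.sum_eq_zero fun s _ => ?_
      rw [Finset.mem_Icc] at ht
      rw [if_neg]
      rw [Fin.forall_fin_succ, Fin.sum_univ_succ]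
      simp only [Fin.cons_zero, Fin.cons_succ]
      rintro ⟨⟨h, _⟩, h'⟩
      exact ht ⟨h, by omega⟩
  rw [h1, Fin.sum_univ_eq_sum_range (fun t => if t ∈ Finset.Icc 1 N then
        GG W L k (N - t) (fun y => ∑ x, ν x * W t x y) else 0) (L + 1), ← Finset.sum_filter]
  refine Finset.sum_congr ?_ fun _ _ => rfl
  ext t
  simp
  omega

lemma GG_eq {S : Type*} [Fintype S] (W : ℕ → S → S → ℝ) (L k : ℕ) :
    ∀ (N : ℕ), N ≤ L → ∀ ν : S → ℝ, GG W L k N ν = ∑ x, ν x * uK W k N x := by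
  induction k with
  | zero =>
    intro N hN ν
    simp only [GG, uK, sum_cons]
    by_cases h : N = 0
    · simp [h]
    · simp [h, Ne.symm h]
  | succ k ih =>
    intro N hN ν
    rw [GG_succ W L k N hN]
    simp only [uK, Finset.mul_sum]
    rw [Finset.sum_comm]
    refine Finset.sum_congr rfl fun t ht => ?_
    rw [ih _ (by omega)]
    rw [Finset.sum_comm]
    refine Finset.sum_congr rfl fun y _ => ?_
    rw [Finset.sum_mul]
    refine Finset.sum_congr rfl fun z _ => ?_
    ring

lemma pinSum_eq {S : Type*} [Fintype S] (μ0 : S → ℝ) (W : ℕ → S → S → ℝ) (N : ℕ) (hN : 1 ≤ N) :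
    pinSum μ0 W N = ∑ x, μ0 x * vN W N x := by
  have h1 : pinSum μ0 W N = ∑ k ∈ Finset.Icc 1 N, GG W N k N μ0 := rfl
  rw [h1]
  simp only [GG_eq W N _ N le_rfl]
  rw [Finset.sum_comm]
  refine Finset.sum_congr rfl fun x _ => ?_
  rw [← Finset.mul_sum]
  congr 1
  unfold vN
  refine Finset.sum_subset (fun a ha => ?_) (fun k hk hk' => ?_)
  · simp at ha ⊢; omega
  · have : k = 0 := by simp at hk hk'; omega
    subst this
    simp only [uK]
    rw [if_neg (by omega)]

/-! ### bounds on `vN` -/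

lemma vN_nonneg {S : Type*} [Fintype S] (W : ℕ → S → S → ℝ)
    (hW : ∀ t, 1 ≤ t → ∀ x y, 0 ≤ W t x y) : ∀ N x, 0 ≤ vN W N x := by
  intro N
  induction N using Nat.strong_induction_on with
  | _ N ih =>
    intro x
    rcases Nat.eq_zero_or_pos N with h | h
    · subst h; rw [vN_zero]; norm_num
    · rw [vN_rec W N h]
      refine Finset.sum_nonneg fun t ht => Finset.sum_nonneg fun y _ => ?_
      rw [Finset.mem_Icc] at ht
      exact mul_nonneg (hW t ht.1 x y) (ih _ (by omega) y)

/-- supersolution bound -/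
lemma vN_le {S : Type*} [Fintype S] (W : ℕ → S → S → ℝ)
    (hW : ∀ t, 1 ≤ t → ∀ x y, 0 ≤ W t x y) (ξ : S → ℝ) (hξ : ∀ x, 1 ≤ ξ x) (b : ℝ) (hb : 0 ≤ b)
    (hA : ∀ N x, ∑ t ∈ Finset.Icc 1 N, ∑ y, W t x y * ξ y ≤ Real.exp b * ξ x) :
    ∀ N x, vN W N x ≤ Real.exp (b * N) * ξ x := by
  intro N
  induction N using Nat.strong_induction_on with
  | _ N ih =>
    intro x
    rcases Nat.eq_zero_or_pos N with h | h
    · subst h; rw [vN_zero]; simpa using hξ x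
    · rw [vN_rec W N h]
      calc _ ≤ ∑ t ∈ Finset.Icc 1 N, ∑ y, W t x y * (Real.exp (b * (N - 1)) * ξ y) := by
            refine Finset.sum_le_sum fun t ht => Finset.sum_le_sum fun y _ => ?_
            rw [Finset.mem_Icc] at ht
            refine mul_le_mul_of_nonneg_left ?_ (hW t ht.1 x y)
            refine (ih _ (by omega) y).trans ?_
            refine mul_le_mul_of_nonneg_right ?_ (by linarith [hξ y])
            refine Real.exp_le_exp.2 (mul_le_mul_of_nonneg_left ?_ hb)
            rw [Nat.cast_sub ht.2]
            have : (1 : ℝ) ≤ t := by exact_mod_cast ht.1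
            linarith
        _ = Real.exp (b * (N - 1)) * ∑ t ∈ Finset.Icc 1 N, ∑ y, W t x y * ξ y := by
            simp only [Finset.mul_sum]
            refine Finset.sum_congr rfl fun t ht => Finset.sum_congr rfl fun y _ => ?_
            ring
        _ ≤ Real.exp (b * (N - 1)) * (Real.exp b * ξ x) :=
            mul_le_mul_of_nonneg_left (hA N x) (Real.exp_pos _).le
        _ = Real.exp (b * N) * ξ x := by
            rw [← mul_assoc, ← Real.exp_add]
            congr 2
            ring

/-- subsolution bound -/
lemma le_vN {S : Type*} [Fintype S] (W : ℕ → S → S → ℝ)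
    (hW : ∀ t, 1 ≤ t → ∀ x y, 0 ≤ W t x y) (ξ : S → ℝ) (hξ : ∀ x, 0 < ξ x) (b : ℝ)
    (hb : 0 ≤ b) (T : ℕ) (c : ℝ) (hc : 0 ≤ c)
    (h0 : ∀ N, N < T → ∀ x, c * (Real.exp (b * N) * ξ x) ≤ vN W N x) (hT1 : 1 ≤ T)
    (hA : ∀ x, Real.exp (b * T) * ξ x ≤ ∑ t ∈ Finset.Icc 1 T, ∑ y, W t x y * ξ y) :
    ∀ (N : ℕ) x, c * (Real.exp (b * N) * ξ x) ≤ vN W N x := by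
  intro N
  induction N using Nat.strong_induction_on with
  | _ N ih =>
    intro x
    rcases lt_or_ge N T with h | h
    · exact h0 N h x
    · rw [vN_rec W N (by omega)]
      calc c * (Real.exp (b * N) * ξ x)
          = c * Real.exp (b * (N - T)) * (Real.exp (b * T) * ξ x) := by
            rw [mul_assoc, ← mul_assoc (Real.exp (b * (N - T))), ← Real.exp_add]
            congr 3
            ring_nf
        _ ≤ c * Real.exp (b * (N - T)) * ∑ t ∈ Finset.Icc 1 T, ∑ y, W t x y * ξ y :=
            mul_le_mul_of_nonneg_left (hA x) (mul_nonneg hc (Real.exp_pos _).le)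
        _ = ∑ t ∈ Finset.Icc 1 T, ∑ y, W t x y * (c * (Real.exp (b * (N - T)) * ξ y)) := by
            simp only [Finset.mul_sum]
            refine Finset.sum_congr rfl fun t ht => Finset.sum_congr rfl fun y _ => ?_
            ring
        _ ≤ ∑ t ∈ Finset.Icc 1 T, ∑ y, W t x y * vN W (N - t) y := by
            refine Finset.sum_le_sum fun t ht => Finset.sum_le_sum fun y _ => ?_
            rw [Finset.mem_Icc] at ht
            refine mul_le_mul_of_nonneg_left ?_ (hW t ht.1 x y)
            refine le_trans ?_ (ih _ (by omega) y)
            refine mul_le_mul_of_nonneg_left ?_ hc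
            refine mul_le_mul_of_nonneg_right ?_ (hξ y).le
            refine Real.exp_le_exp.2 (mul_le_mul_of_nonneg_left ?_ hb)
            rw [Nat.cast_sub (by omega)]
            have : (t : ℝ) ≤ T := by exact_mod_cast ht.2
            linarith
        _ ≤ _ := by
            refine Finset.sum_le_sum_of_subset_of_nonneg ?_ ?_
            · exact Finset.Icc_subset_Icc le_rfl h
            · intro t ht _
              rw [Finset.mem_Icc] at ht
              exact Finset.sum_nonneg fun y _ => mul_nonneg (hW t ht.1 x y) (vN_nonneg W hW _ _)

lemma vN_super {S : Type*} [Fintype S] (W : ℕ → S → S → ℝ)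
    (hW : ∀ t, 1 ≤ t → ∀ x y, 0 ≤ W t x y) (M : ℕ) (m : ℝ) (hm : ∀ x, m ≤ vN W M x) :
    ∀ N x, vN W N x * m ≤ vN W (N + M) x := by
  intro N
  induction N using Nat.strong_induction_on with
  | _ N ih =>
    intro x
    rcases Nat.eq_zero_or_pos N with h | h
    · subst h; rw [vN_zero, one_mul, zero_add]; exact hm x
    · rw [vN_rec W N h, vN_rec W (N + M) (by omega)]
      calc _ = ∑ t ∈ Finset.Icc 1 N, ∑ y, W t x y * (vN W (N - t) y * m) := by
            simp only [Finset.sum_mul]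
            refine Finset.sum_congr rfl fun t ht => Finset.sum_congr rfl fun y _ => ?_
            ring
        _ ≤ ∑ t ∈ Finset.Icc 1 N, ∑ y, W t x y * vN W (N + M - t) y := by
            refine Finset.sum_le_sum fun t ht => Finset.sum_le_sum fun y _ => ?_
            rw [Finset.mem_Icc] at ht
            refine mul_le_mul_of_nonneg_left ?_ (hW t ht.1 x y)
            rw [show N + M - t = N - t + M by omega]
            exact ih _ (by omega) y
        _ ≤ _ := by
            refine Finset.sum_le_sum_of_subset_of_nonneg ?_ ?_
            · exact Finset.Icc_subset_Icc le_rfl (by omega)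
            · intro t ht _
              rw [Finset.mem_Icc] at ht
              exact Finset.sum_nonneg fun y _ => mul_nonneg (hW t ht.1 x y) (vN_nonneg W hW _ _)

lemma vN_step {S : Type*} [Fintype S] (W : ℕ → S → S → ℝ)
    (hW : ∀ t, 1 ≤ t → ∀ x y, 0 ≤ W t x y) (N t : ℕ) (ht : 1 ≤ t) (x : S) :
    ∑ y, W t x y * vN W N y ≤ vN W (N + t) x := by
  rw [vN_rec W (N + t) (by omega)]
  have h := Finset.single_le_sum (f := fun t' => ∑ y, W t' x y * vN W (N + t - t') y)
    (s := Finset.Icc 1 (N + t)) (a := t) (fun t' ht' => by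
      rw [Finset.mem_Icc] at ht'
      exact Finset.sum_nonneg fun y _ => mul_nonneg (hW t' ht'.1 x y) (vN_nonneg W hW _ _))
    (by rw [Finset.mem_Icc]; omega)
  simpa using h

lemma vN_ge_row {S : Type*} [Fintype S] (W : ℕ → S → S → ℝ)
    (hW : ∀ t, 1 ≤ t → ∀ x y, 0 ≤ W t x y) (N : ℕ) (hN : 1 ≤ N) (x : S) :
    ∑ y, W N x y ≤ vN W N x := by
  simpa [vN_zero] using vN_step W hW 0 N hN x

lemma exists_limit {S : Type*} [Fintype S] [Nonempty S] (W : ℕ → S → S → ℝ)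
    (hW : ∀ t, 1 ≤ t → ∀ x y, 0 ≤ W t x y) (κ : ℕ → ℝ) (hκ : ∀ t, 1 ≤ t → 0 < κ t)
    (hrow : ∀ t, 1 ≤ t → ∀ x, κ t ≤ ∑ y, W t x y)
    (hκlim : Tendsto (fun N : ℕ => Real.log (κ N) / N) atTop (𝓝 0))
    (hirr : ∀ x y, ∃ t, 1 ≤ t ∧ 0 < W t x y)
    (C b : ℝ) (hb : ∀ N x, vN W N x ≤ Real.exp (b * N) * C)
    (μ0 : S → ℝ) (hμ0 : ∀ x, 0 ≤ μ0 x) (hμ1 : ∑ x, μ0 x = 1) :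
    ∃ F : ℝ, 0 ≤ F ∧
      Tendsto (fun N : ℕ => Real.log (∑ x, μ0 x * vN W N x) / N) atTop (𝓝 F) := by
  set m : ℕ → ℝ := fun N => ⨅ x, vN W N x with hm
  have hmle : ∀ N x, m N ≤ vN W N x := fun N x => ciInf_le (Finite.bddBelow_range _) x
  have hmex : ∀ N, ∃ x, vN W N x = m N := fun N => exists_eq_ciInf_of_finite
  have hmκ : ∀ N, 1 ≤ N → κ N ≤ m N := by
    intro N hN
    obtain ⟨x, hx⟩ := hmex N
    rw [← hx]
    exact (hrow N hN x).trans (vN_ge_row W hW N hN x)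
  have hmpos : ∀ N, 0 < m N := by
    intro N
    rcases Nat.eq_zero_or_pos N with h | h
    · subst h
      obtain ⟨x, hx⟩ := hmex 0
      rw [← hx, vN_zero]; norm_num
    · exact (hκ N h).trans_le (hmκ N h)
  have hvpos : ∀ N x, 0 < vN W N x := fun N x => (hmpos N).trans_le (hmle N x)
  have hsuper : ∀ N M, m N * m M ≤ m (N + M) := by
    intro N M
    obtain ⟨x, hx⟩ := hmex (N + M)
    rw [← hx]
    exact (mul_le_mul_of_nonneg_right (hmle N x) (hmpos M).le).trans
      (vN_super W hW M (m M) (hmle M) N x)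
  have hsub : Subadditive (fun N => - Real.log (m N)) := by
    intro N M
    have := Real.log_le_log (mul_pos (hmpos N) (hmpos M)) (hsuper N M)
    rw [Real.log_mul (hmpos N).ne' (hmpos M).ne'] at this
    linarith
  have hCpos : 0 < C := by
    have := (hvpos 0 (Classical.arbitrary S)).trans_le (hb 0 _)
    simpa using this
  have hmup : ∀ N : ℕ, Real.log (m N) ≤ b * N + Real.log C := by
    intro N
    have := Real.log_le_log (hmpos N) ((hmle N (Classical.arbitrary S)).trans (hb N _))
    rwa [Real.log_mul (Real.exp_pos _).ne' hCpos.ne', Real.log_exp] at this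
  have hbdd : BddBelow (Set.range fun N : ℕ => - Real.log (m N) / N) := by
    refine ⟨-(|b| + |Real.log C|), ?_⟩
    rintro _ ⟨N, rfl⟩
    rcases Nat.eq_zero_or_pos N with h | h
    · subst h
      simp only [Nat.cast_zero, div_zero]
      have := abs_nonneg b
      have := abs_nonneg (Real.log C)
      linarith
    · have hN : (1 : ℝ) ≤ N := by exact_mod_cast h
      show _ ≤ - Real.log (m N) / N
      rw [le_div_iff₀ (by linarith)]
      have h1 := hmup N
      have h2 := le_abs_self b
      have h3 := le_abs_self (Real.log C)
      have h4 := abs_nonneg (Real.log C)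
      nlinarith
  have hlim := hsub.tendsto_lim hbdd
  set F := - hsub.lim with hF
  have hlimm : Tendsto (fun N : ℕ => Real.log (m N) / N) atTop (𝓝 F) := by
    have := hlim.neg
    refine this.congr fun N => ?_
    ring
  have hF0 : 0 ≤ F := by
    refine le_of_tendsto_of_tendsto hκlim hlimm ?_
    filter_upwards [eventually_ge_atTop 1] with N hN
    exact div_le_div_of_nonneg_right (Real.log_le_log (hκ N hN) (hmκ N hN)) (Nat.cast_nonneg N)
  refine ⟨F, hF0, ?_⟩
  -- comparison
  choose τ hτ1 hτ using hirr
  set T : ℕ := ∑ x, ∑ y, τ x y with hT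
  have hτT : ∀ x y, τ x y ≤ T := by
    intro x y
    calc τ x y ≤ ∑ y, τ x y := Finset.single_le_sum (f := fun y => τ x y)
          (fun _ _ => Nat.zero_le _) (Finset.mem_univ y)
      _ ≤ T := Finset.single_le_sum (f := fun x => ∑ y, τ x y)
          (fun _ _ => Nat.zero_le _) (Finset.mem_univ x)
  obtain ⟨p, hp⟩ := Finite.exists_min (fun p : S × S =>
    W (τ p.1 p.2) p.1 p.2 * m (T - τ p.1 p.2))
  set c := W (τ p.1 p.2) p.1 p.2 * m (T - τ p.1 p.2) with hc
  have hcpos : 0 < c := mul_pos (hτ _ _) (hmpos _)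
  have hcomp : ∀ N x y, c * vN W N y ≤ vN W (N + T) x := by
    intro N x y
    have h1 := vN_super W hW (T - τ x y) (m (T - τ x y)) (hmle _) (N + τ x y) x
    rw [show N + τ x y + (T - τ x y) = N + T by have := hτT x y; omega] at h1
    have h2 : W (τ x y) x y * vN W N y ≤ vN W (N + τ x y) x := by
      refine le_trans ?_ (vN_step W hW N (τ x y) (hτ1 x y) x)
      exact Finset.single_le_sum (f := fun y' => W (τ x y) x y' * vN W N y')
        (fun y' _ => mul_nonneg (hW _ (hτ1 x y) x y') (hvpos _ _).le) (Finset.mem_univ y)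
    have h3 := hp (x, y)
    simp only at h3
    calc c * vN W N y ≤ (W (τ x y) x y * m (T - τ x y)) * vN W N y :=
          mul_le_mul_of_nonneg_right h3 (hvpos _ _).le
      _ = (W (τ x y) x y * vN W N y) * m (T - τ x y) := by ring
      _ ≤ vN W (N + τ x y) x * m (T - τ x y) := mul_le_mul_of_nonneg_right h2 (hmpos _).le
      _ ≤ _ := h1
  have hlow : ∀ N, m N ≤ ∑ x, μ0 x * vN W N x := by
    intro N
    calc m N = ∑ x, μ0 x * m N := by rw [← Finset.sum_mul, hμ1, one_mul]
      _ ≤ _ := Finset.sum_le_sum fun x _ => mul_le_mul_of_nonneg_left (hmle N x) (hμ0 x)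
  have hupp : ∀ N, c * ∑ x, μ0 x * vN W N x ≤ m (N + T) := by
    intro N
    obtain ⟨z, hz⟩ := hmex (N + T)
    calc c * ∑ x, μ0 x * vN W N x = ∑ x, μ0 x * (c * vN W N x) := by
          rw [Finset.mul_sum]; refine Finset.sum_congr rfl fun x _ => by ring
      _ ≤ ∑ x, μ0 x * m (N + T) := Finset.sum_le_sum fun x _ =>
          mul_le_mul_of_nonneg_left (by rw [← hz]; exact hcomp N z x) (hμ0 x)
      _ = m (N + T) := by rw [← Finset.sum_mul, hμ1, one_mul]
  have hZpos : ∀ N, 0 < ∑ x, μ0 x * vN W N x := fun N => (hmpos N).trans_le (hlow N)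
  have hup_lim : Tendsto (fun N : ℕ => (Real.log (m (N + T)) - Real.log c) / N) atTop (𝓝 F) := by
    have h1 : Tendsto (fun N : ℕ => Real.log (m (N + T)) / ((N + T : ℕ) : ℝ)) atTop (𝓝 F) :=
      hlimm.comp (tendsto_add_atTop_nat T)
    have h2 : Tendsto (fun N : ℕ => (T : ℝ) / (N : ℝ)) atTop (𝓝 0) :=
      tendsto_const_div_atTop_nhds_zero_nat _
    have h3 : Tendsto (fun N : ℕ => Real.log c / (N : ℝ)) atTop (𝓝 0) :=
      tendsto_const_div_atTop_nhds_zero_nat _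
    have h4 := (h1.mul (h2.const_add 1)).sub h3
    rw [add_zero, mul_one, sub_zero] at h4
    refine h4.congr' ?_
    filter_upwards [eventually_ge_atTop 1] with N hN
    have hN' : (0 : ℝ) < N := by exact_mod_cast hN
    have hNT : (0 : ℝ) < N + T := by positivity
    push_cast
    field_simp
  refine tendsto_of_tendsto_of_tendsto_of_le_of_le hlimm hup_lim ?_ ?_
  · intro N
    exact div_le_div_of_nonneg_right (Real.log_le_log (hmpos N) (hlow N)) (Nat.cast_nonneg N)
  · intro N
    refine div_le_div_of_nonneg_right ?_ (Nat.cast_nonneg N)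
    have := Real.log_le_log (mul_pos hcpos (hZpos N)) (hupp N)
    rw [Real.log_mul hcpos.ne' (hZpos N).ne'] at this
    linarith

lemma limit_le_zero (u : ℕ → ℝ) (F C : ℝ) (hu : ∀ᶠ N in atTop, 0 ≤ u N) (hC1 : 1 ≤ C)
    (hC : ∀ᶠ N in atTop, u N ≤ C)
    (h : Tendsto (fun N : ℕ => Real.log (u N) / N) atTop (𝓝 F)) : F ≤ 0 := by
  refine le_of_tendsto_of_tendsto h
    (tendsto_const_div_atTop_nhds_zero_nat (Real.log C)) ?_
  filter_upwards [hu, hC] with N h1 h2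
  refine div_le_div_of_nonneg_right ?_ (Nat.cast_nonneg N)
  rcases h1.eq_or_lt with h0 | h0
  · rw [← h0, Real.log_zero]; exact Real.log_nonneg hC1
  · exact Real.log_le_log h0 h2

lemma le_limit (u : ℕ → ℝ) (F c b : ℝ) (hc : 0 < c)
    (hC : ∀ᶠ N : ℕ in atTop, c * Real.exp (b * N) ≤ u N)
    (h : Tendsto (fun N : ℕ => Real.log (u N) / N) atTop (𝓝 F)) : b ≤ F := by
  have h1 : Tendsto (fun N : ℕ => Real.log c / (N : ℝ) + b) atTop (𝓝 (0 + b)) :=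
    (tendsto_const_div_atTop_nhds_zero_nat (Real.log c)).add_const b
  rw [zero_add] at h1
  refine le_of_tendsto_of_tendsto h1 h ?_
  filter_upwards [hC, eventually_ge_atTop 1] with N h1 h2
  have hN' : (0 : ℝ) < N := by exact_mod_cast h2
  have := Real.log_le_log (by positivity) h1
  rw [Real.log_mul hc.ne' (Real.exp_pos _).ne', Real.log_exp] at this
  rw [le_div_iff₀ hN']
  calc _ = Real.log c + b * N := by field_simp
    _ ≤ _ := this

lemma sum_Icc_shift (g : ℕ → ℝ) (N : ℕ) :
    ∑ t ∈ Finset.Icc 1 N, g t = ∑ t ∈ Finset.range N, g (t + 1) := by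
  induction N with
  | zero => simp
  | succ N ih => rw [Finset.sum_Icc_succ_top (by omega), ih, Finset.sum_range_succ]

lemma pow_stoch {S : Type*} [Fintype S] [DecidableEq S] (Q : Matrix S S ℝ)
    (hQ0 : ∀ x y, 0 ≤ Q x y) (hQ1 : ∀ x, ∑ y, Q x y = 1) (t : ℕ) :
    (∀ x y, 0 ≤ (Q ^ t) x y) ∧ ∀ x, ∑ y, (Q ^ t) x y = 1 := by
  induction t with
  | zero =>
    refine ⟨fun x y => ?_, fun x => ?_⟩
    · rw [pow_zero, Matrix.one_apply]; split_ifs <;> norm_num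
    · simp [Matrix.one_apply]
  | succ t ih =>
    refine ⟨fun x y => ?_, fun x => ?_⟩
    · rw [pow_succ, Matrix.mul_apply]
      exact Finset.sum_nonneg fun z _ => mul_nonneg (ih.1 x z) (hQ0 z y)
    · simp only [pow_succ, Matrix.mul_apply]
      rw [Finset.sum_comm]
      simp only [← Finset.mul_sum, hQ1, mul_one]
      exact ih.2 x

/-- Assuming `(1/N) log K(N) → 0`, for every `β ≥ 0` and `h` the
annealed free energy `Fᵃ(β,h) = lim (1/N) log Z^a_N(β,h)` exists, is nonnegative,
is positive exactly when `h > -log λ(0,β,0)`; the annealed critical curve is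
`h_c^a(β) = sup{h : Fᵃ(β,h) = 0} = -log λ(0,β,0)`. Here `lam b β h` is the
Perron–Frobenius eigenvalue of `A(b,β,h)`, characterized as the eigenvalue
admitting an entrywise positive right eigenvector. -/
theorem statement2 {S : Type*} [Fintype S] [DecidableEq S] [Nonempty S]
    (K : ℕ → ℝ) (hKpos : ∀ n, 1 ≤ n → 0 < K n) (hKsum : ∑' n : ℕ, K (n + 1) = 1)
    (hK : Tendsto (fun N : ℕ => Real.log (K N) / N) atTop (𝓝 0))
    (Q : Matrix S S ℝ) (hQ0 : ∀ x y, 0 ≤ Q x y) (hQ1 : ∀ x, ∑ y, Q x y = 1)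
    (hQirr : ∀ x y, ∃ t, 1 ≤ t ∧ 0 < (Q ^ t) x y)
    (μ0 : S → ℝ) (hμ0 : ∀ x, 0 ≤ μ0 x) (hμ1 : ∑ x, μ0 x = 1)
    (hμinv : ∀ y, ∑ x, μ0 x * Q x y = μ0 y)
    (f : S → ℝ)
    (hAsum : ∀ b : ℝ, 0 ≤ b → ∀ β : ℝ, 0 ≤ β → ∀ h : ℝ, ∀ x y : S,
      Summable fun t : ℕ =>
        K (t + 1) * (Q ^ (t + 1)) x y * Real.exp (β * f y + h) * Real.exp (-b * (t + 1)))
    (lam : ℝ → ℝ → ℝ → ℝ)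
    (hlam : ∀ b : ℝ, 0 ≤ b → ∀ β : ℝ, 0 ≤ β → ∀ h : ℝ, ∃ ξ : S → ℝ, (∀ x, 0 < ξ x) ∧
      (Amat K Q f b β h) *ᵥ ξ = lam b β h • ξ) :
    ∀ β : ℝ, 0 ≤ β → ∃ Fa : ℝ → ℝ,
      (∀ h : ℝ, 0 ≤ Fa h ∧
        Tendsto (fun N : ℕ => Real.log (Za K Q μ0 f β h N) / N) atTop (𝓝 (Fa h)) ∧
        (0 < Fa h ↔ -Real.log (lam 0 β 0) < h)) ∧
      sSup {h : ℝ | Fa h = 0} = -Real.log (lam 0 β 0) := by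
  intro β hβ
  set lam0 := lam 0 β 0 with hlam0
  -- normalised eigenvector
  obtain ⟨ξ, hξ1, hAξ⟩ : ∃ ξ : S → ℝ, (∀ x, 1 ≤ ξ x) ∧
      (Amat K Q f 0 β 0) *ᵥ ξ = lam0 • ξ := by
    obtain ⟨ξ, hξ, h⟩ := hlam 0 le_rfl β hβ 0
    obtain ⟨p, hp⟩ := Finite.exists_min ξ
    refine ⟨(ξ p)⁻¹ • ξ, fun x => ?_, ?_⟩
    · rw [Pi.smul_apply, smul_eq_mul, inv_mul_eq_div, le_div_iff₀ (hξ p), one_mul]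
      exact hp x
    · rw [Matrix.mulVec_smul, h, smul_comm]
  have hξ : ∀ x, 0 < ξ x := fun x => by linarith [hξ1 x]
  have hQt0 : ∀ t x y, 0 ≤ (Q ^ t) x y := fun t => (pow_stoch Q hQ0 hQ1 t).1
  have hQt1 : ∀ t x, ∑ y, (Q ^ t) x y = 1 := fun t => (pow_stoch Q hQ0 hQ1 t).2
  set W : ℝ → ℕ → S → S → ℝ := fun h t x y => K t * (Q ^ t) x y * Real.exp (β * f y + h) with hWdef
  have hW : ∀ h t, 1 ≤ t → ∀ x y, 0 ≤ W h t x y := fun h t ht x y =>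
    mul_nonneg (mul_nonneg (hKpos t ht).le (hQt0 t x y)) (Real.exp_pos _).le
  have hsum : ∀ h x, HasSum (fun t : ℕ => ∑ y, W h (t + 1) x y * ξ y)
      (Real.exp h * lam0 * ξ x) := by
    intro h x
    have h1 : ∀ y, HasSum (fun t : ℕ => W h (t + 1) x y * ξ y)
        (Real.exp h * (Amat K Q f 0 β 0 x y * ξ y)) := by
      intro y
      have h2 := ((hAsum 0 le_rfl β hβ 0 x y).hasSum.mul_right (ξ y)).mul_left (Real.exp h)
      have h3 : (fun t : ℕ => W h (t + 1) x y * ξ y) = fun t : ℕ => Real.exp h *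
          (K (t + 1) * (Q ^ (t + 1)) x y * Real.exp (β * f y + 0) *
            Real.exp (-0 * (t + 1)) * ξ y) := by
        funext t
        simp only [hWdef, Real.exp_add, neg_zero, zero_mul, Real.exp_zero, mul_one]
        ring
      rw [h3]
      exact h2
    have h3 := hasSum_sum (s := Finset.univ) (fun y _ => h1 y)
    have h4 := congrFun hAξ x
    simp only [Matrix.mulVec, dotProduct, Pi.smul_apply, smul_eq_mul] at h4
    rw [← Finset.mul_sum, h4, ← mul_assoc] at h3
    exact h3
  have hterm : ∀ h x t, 0 ≤ ∑ y, W h (t + 1) x y * ξ y := fun h x t =>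
    Finset.sum_nonneg fun y _ => mul_nonneg (hW h _ (by omega) x y) (hξ y).le
  have hpart : ∀ h N x, ∑ t ∈ Finset.Icc 1 N, ∑ y, W h t x y * ξ y ≤
      Real.exp h * lam0 * ξ x := by
    intro h N x
    rw [sum_Icc_shift]
    exact sum_le_hasSum _ (fun t _ => hterm h x t) (hsum h x)
  -- row lower bound
  have hrow : ∀ h : ℝ, ∃ c : ℝ, 0 < c ∧ ∀ t, 1 ≤ t → ∀ x, K t * c ≤ ∑ y, W h t x y := by
    intro h
    obtain ⟨p, hp⟩ := Finite.exists_min (fun y => Real.exp (β * f y + h))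
    refine ⟨_, Real.exp_pos (β * f p + h), fun t ht x => ?_⟩
    calc K t * Real.exp (β * f p + h)
        = ∑ y, K t * (Q ^ t) x y * Real.exp (β * f p + h) := by
          rw [← Finset.sum_mul, ← Finset.mul_sum, hQt1, mul_one]
      _ ≤ _ := Finset.sum_le_sum fun y _ => mul_le_mul_of_nonneg_left (hp y)
          (mul_nonneg (hKpos t ht).le (hQt0 t x y))
  have hlampos : 0 < lam0 := by
    obtain ⟨c, hc, hrow0⟩ := hrow 0
    let x := Classical.arbitrary S
    have h1 := hpart 0 1 x
    have h2 := hrow0 1 le_rfl x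
    have h3 : ∑ y, W 0 1 x y ≤ ∑ y, W 0 1 x y * ξ y := Finset.sum_le_sum fun y _ =>
      le_mul_of_one_le_right (hW 0 1 le_rfl x y) (hξ1 y)
    have h4 : 0 < K 1 * c := mul_pos (hKpos 1 le_rfl) hc
    simp only [Finset.Icc_self, Finset.sum_singleton, Real.exp_zero, one_mul] at h1
    have h5 : 0 < lam0 * ξ x := by linarith
    exact (mul_pos_iff_of_pos_right (hξ x)).1 h5
  have hirr : ∀ h x y, ∃ t, 1 ≤ t ∧ 0 < W h t x y := by
    intro h x y
    obtain ⟨t, ht, hq⟩ := hQirr x y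
    exact ⟨t, ht, mul_pos (mul_pos (hKpos t ht) hq) (Real.exp_pos _)⟩
  have key : ∀ h : ℝ, ∃ F : ℝ, 0 ≤ F ∧
      Tendsto (fun N : ℕ => Real.log (Za K Q μ0 f β h N) / N) atTop (𝓝 F) ∧
      (0 < F ↔ -Real.log lam0 < h) := by
    intro h
    have hL : 0 < Real.exp h * lam0 := mul_pos (Real.exp_pos h) hlampos
    have hlogL : Real.log (Real.exp h * lam0) = h + Real.log lam0 := by
      rw [Real.log_mul (Real.exp_pos h).ne' hlampos.ne', Real.log_exp]
    obtain ⟨c, hc, hrowh⟩ := hrow h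
    have hbound : ∀ b : ℝ, 0 ≤ b → h + Real.log lam0 ≤ b → ∀ N x,
        vN (W h) N x ≤ Real.exp (b * N) * ξ x := by
      intro b hb hb'
      refine vN_le (W h) (hW h) ξ hξ1 b hb fun N x => (hpart h N x).trans ?_
      refine mul_le_mul_of_nonneg_right ?_ (hξ x).le
      rw [← Real.exp_log hL, hlogL]
      exact Real.exp_le_exp.2 hb'
    obtain ⟨F, hF0, hF⟩ := exists_limit (W h) (hW h) (fun t => K t * c)
      (fun t ht => mul_pos (hKpos t ht) hc) hrowh (by
        have h1 := hK.add (tendsto_const_div_atTop_nhds_zero_nat (Real.log c))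
        rw [add_zero] at h1
        refine h1.congr' ?_
        filter_upwards [eventually_ge_atTop 1] with N hN
        rw [Real.log_mul (hKpos N hN).ne' hc.ne', add_div]) (hirr h)
      (∑ x, ξ x) (max 0 (h + Real.log lam0)) (fun N x => by
        refine (hbound _ (le_max_left _ _) (le_max_right _ _) N x).trans ?_
        refine mul_le_mul_of_nonneg_left ?_ (Real.exp_pos _).le
        exact Finset.single_le_sum (fun y _ => (hξ y).le) (Finset.mem_univ x)) μ0 hμ0 hμ1
    refine ⟨F, hF0, ?_, ?_⟩
    · refine hF.congr' ?_
      filter_upwards [eventually_ge_atTop 1] with N hN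
      rw [show Za K Q μ0 f β h N = pinSum μ0 (W h) N from rfl, pinSum_eq μ0 (W h) N hN]
    · constructor
      · intro hFpos
        by_contra hcon
        rw [not_lt] at hcon
        refine absurd (limit_le_zero _ F (max 1 (∑ x, μ0 x * ξ x)) ?_ (le_max_left _ _) ?_ hF)
          (not_le.2 hFpos)
        · exact Eventually.of_forall fun N => Finset.sum_nonneg fun x _ =>
            mul_nonneg (hμ0 x) (vN_nonneg (W h) (hW h) N x)
        · refine Eventually.of_forall fun N => le_trans ?_ (le_max_right _ _)
          refine Finset.sum_le_sum fun x _ => mul_le_mul_of_nonneg_left ?_ (hμ0 x)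
          have := hbound 0 le_rfl (by linarith) N x
          simpa using this
      · intro hh
        set L := Real.exp h * lam0 with hLdef
        have hL1 : 1 < L := by
          rw [← Real.exp_log hL, hlogL]
          exact Real.one_lt_exp_iff.2 (by linarith)
        have hev : ∀ᶠ T : ℕ in atTop, ∀ x, (1 + L) / 2 * ξ x ≤
            ∑ t ∈ Finset.Icc 1 T, ∑ y, W h t x y * ξ y := by
          rw [eventually_all]
          intro x
          have h1 := (hsum h x).tendsto_sum_nat
          have h2 : (1 + L) / 2 * ξ x < L * ξ x :=
            mul_lt_mul_of_pos_right (by linarith) (hξ x)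
          filter_upwards [h1.eventually_const_le h2] with T hT
          rw [sum_Icc_shift]
          exact hT
        obtain ⟨T, hT, hT1⟩ := (hev.and (eventually_ge_atTop 1)).exists
        have hTpos : (0 : ℝ) < T := by exact_mod_cast hT1
        set b := Real.log ((1 + L) / 2) / T with hb
        have hbpos : 0 < b := div_pos (Real.log_pos (by linarith)) hTpos
        have hbT : Real.exp (b * T) = (1 + L) / 2 := by
          rw [hb, div_mul_cancel₀ _ hTpos.ne', Real.exp_log (by linarith)]
        have hvpos : ∀ N x, 0 < vN (W h) N x := by
          intro N x
          rcases Nat.eq_zero_or_pos N with h0 | h0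
          · subst h0; rw [vN_zero]; norm_num
          · exact (mul_pos (hKpos N h0) hc).trans_le
              ((hrowh N h0 x).trans (vN_ge_row (W h) (hW h) N h0 x))
        have : NeZero T := ⟨by omega⟩
        obtain ⟨p, hp⟩ := Finite.exists_min (fun p : Fin T × S =>
          vN (W h) p.1 p.2 / (Real.exp (b * (p.1 : ℕ)) * ξ p.2))
        set d := vN (W h) p.1 p.2 / (Real.exp (b * (p.1 : ℕ)) * ξ p.2) with hd
        have hdpos : 0 < d := div_pos (hvpos _ _) (mul_pos (Real.exp_pos _) (hξ _))
        have hlow := le_vN (W h) (hW h) ξ hξ b hbpos.le T d hdpos.le (fun N hN x => by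
          have := hp (⟨N, hN⟩, x)
          rwa [le_div_iff₀ (mul_pos (Real.exp_pos _) (hξ _))] at this) hT1 (fun x => by
          rw [hbT]; exact hT x)
        refine hbpos.trans_le (le_limit _ F d b hdpos ?_ hF)
        refine Eventually.of_forall fun N => ?_
        calc d * Real.exp (b * N) = ∑ x, μ0 x * (d * Real.exp (b * N)) := by
              rw [← Finset.sum_mul, hμ1, one_mul]
          _ ≤ _ := Finset.sum_le_sum fun x _ => mul_le_mul_of_nonneg_left (by
              refine le_trans ?_ (hlow N x)
              rw [← mul_assoc]
              exact le_mul_of_one_le_right (mul_nonneg hdpos.le (Real.exp_pos _).le) (hξ1 x))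
              (hμ0 x)
  choose Fa hFa using key
  refine ⟨Fa, hFa, ?_⟩
  have hset : {h : ℝ | Fa h = 0} = Set.Iic (-Real.log lam0) := by
    ext h
    simp only [Set.mem_ofPred_eq, Set.mem_Iic]
    rw [← not_lt, ← (hFa h).2.2, not_lt]
    exact ⟨fun h => h.le, fun h' => le_antisymm h' (hFa h).1⟩
  rw [hset, csSup_Iic]
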